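/- Let n ≥ 3 be an integer and p := (n+2)/(n−2). There exists a constant C = C(n) > 0 such that for all reals 0 < δ_j ≤ δ_i ≤ 1, all ξ_i, ξ_j ∈ ℝⁿ with |ξ_i − ξ_j| ≤ δ_i, and every measurable set Ω ⊂ ℝⁿ, one has ∫_Ω U_{δ_i,ξ_i}(x)^{p−1} U_{δ_j,ξ_j}(x) dx ≤ C δ_j^{(n−2)/2}. -/

import Mathlib

open MeasureTheory

/-- The Aubin–Talenti bubble `U_{δ,ξ}` on `ℝⁿ`. -/
noncomputable def bubble (n : ℕ) (δ : ℝ) (ξ x : EuclideanSpace ℝ (Fin n)) : ℝ :=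
  ((n : ℝ) * ((n : ℝ) - 2)) ^ (((n : ℝ) - 2) / 4) *
    (δ / (δ ^ 2 + ‖x - ξ‖ ^ 2)) ^ (((n : ℝ) - 2) / 2)

/-- The radial profile dominating the rescaled product of two bubbles is integrable on `ℝⁿ`. -/
theorem integrable_inv_one_add_norm_sq_sq_mul_inv_norm_pow {n : ℕ} (hn : 3 ≤ n) :
    Integrable (fun y : EuclideanSpace ℝ (Fin n) =>
      ((1 + ‖y‖ ^ 2) ^ 2)⁻¹ * (‖y‖ ^ (n - 2))⁻¹) := by
  obtain ⟨m, rfl⟩ : ∃ m, n = m + 2 := ⟨n - 2, by omega⟩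
  rw [integrable_fun_norm_addHaar (μ := volume) (E := EuclideanSpace ℝ (Fin (m + 2)))
    (f := fun r : ℝ => ((1 + r ^ 2) ^ 2)⁻¹ * (r ^ (m + 2 - 2))⁻¹)]
  refine Integrable.mono' integrable_inv_one_add_sq.integrableOn
    (Measurable.aestronglyMeasurable (by fun_prop)) ?_
  filter_upwards [ae_restrict_mem measurableSet_Ioi] with r hr
  have hr0 : 0 < r := hr
  simp only [finrank_euclideanSpace, Fintype.card_fin, smul_eq_mul, Nat.add_sub_cancel]
  rw [Real.norm_of_nonneg (by positivity)]
  have h : r ^ (m + 2 - 1) * (((1 + r ^ 2) ^ 2)⁻¹ * (r ^ m)⁻¹) = r / (1 + r ^ 2) ^ 2 := by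
    rw [show m + 2 - 1 = m + 1 by omega, pow_succ]
    field_simp
  rw [h, inv_eq_one_div, div_le_div_iff₀ (by positivity) (by positivity)]
  nlinarith [sq_nonneg (r - 1), sq_nonneg r]

theorem bubble_nonneg {n : ℕ} (hn : 3 ≤ n) {δ : ℝ} (hδ : 0 < δ)
    (ξ x : EuclideanSpace ℝ (Fin n)) : 0 ≤ bubble n δ ξ x := by
  have hn' : (3 : ℝ) ≤ n := by exact_mod_cast hn
  have : 0 ≤ (n : ℝ) * ((n : ℝ) - 2) := mul_nonneg (by linarith) (by linarith)
  unfold bubble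
  positivity

/-- Away from its center, a bubble is bounded by the corresponding multiple of the
fundamental solution. -/
theorem bubble_le_inv_norm_pow {n : ℕ} (hn : 3 ≤ n) {δ : ℝ} (hδ : 0 < δ)
    {ξ x : EuclideanSpace ℝ (Fin n)} (hx : x ≠ ξ) :
    bubble n δ ξ x ≤ ((n : ℝ) * ((n : ℝ) - 2)) ^ (((n : ℝ) - 2) / 4) *
      (δ ^ (((n : ℝ) - 2) / 2) * (‖x - ξ‖ ^ (n - 2))⁻¹) := by
  have hn' : (3 : ℝ) ≤ n := by exact_mod_cast hn
  have ha : 0 ≤ (n : ℝ) * ((n : ℝ) - 2) := mul_nonneg (by linarith) (by linarith)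
  have hr : 0 < ‖x - ξ‖ := norm_pos_iff.2 (sub_ne_zero.2 hx)
  have hpow : (‖x - ξ‖ ^ 2) ^ (((n : ℝ) - 2) / 2) = ‖x - ξ‖ ^ (n - 2) := by
    rw [← Real.rpow_natCast, ← Real.rpow_mul hr.le, ← Real.rpow_natCast,
      Nat.cast_sub (by omega)]
    congr 1
    push_cast
    ring
  unfold bubble
  refine mul_le_mul_of_nonneg_left ?_ (by positivity)
  rw [← hpow, ← div_eq_mul_inv, ← Real.div_rpow hδ.le (by positivity)]
  refine Real.rpow_le_rpow (by positivity) ?_ (by linarith)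
  gcongr
  nlinarith [sq_nonneg δ]

theorem bubble_rpow_sub_one {n : ℕ} (hn : 3 ≤ n) {δ : ℝ} (hδ : 0 < δ)
    (ξ x : EuclideanSpace ℝ (Fin n)) :
    bubble n δ ξ x ^ (((n : ℝ) + 2) / ((n : ℝ) - 2) - 1) =
      (n : ℝ) * ((n : ℝ) - 2) * (δ / (δ ^ 2 + ‖x - ξ‖ ^ 2)) ^ 2 := by
  have hn' : (3 : ℝ) ≤ n := by exact_mod_cast hn
  have ha : 0 ≤ (n : ℝ) * ((n : ℝ) - 2) := mul_nonneg (by linarith) (by linarith)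
  have hn2 : (n : ℝ) - 2 ≠ 0 := by linarith
  unfold bubble
  rw [Real.mul_rpow (by positivity) (by positivity), ← Real.rpow_mul ha,
    ← Real.rpow_mul (by positivity)]
  have h1 : ((n : ℝ) - 2) / 4 * (((n : ℝ) + 2) / ((n : ℝ) - 2) - 1) = 1 := by
    field_simp
    ring
  have h2 : ((n : ℝ) - 2) / 2 * (((n : ℝ) + 2) / ((n : ℝ) - 2) - 1) = (2 : ℕ) := by
    push_cast
    field_simp
    ring
  rw [h1, h2, Real.rpow_one, Real.rpow_natCast]

/-- Moving the center of the weight by at most the scale `δ` costs a factor `3`. -/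
theorem div_sq_add_norm_sub_sq_le {E : Type*} [SeminormedAddCommGroup E] {δ : ℝ} (hδ : 0 < δ)
    {ξ η : E} (h : ‖ξ - η‖ ≤ δ) (x : E) :
    δ / (δ ^ 2 + ‖x - ξ‖ ^ 2) ≤ 3 * (δ / (δ ^ 2 + ‖x - η‖ ^ 2)) := by
  have htri : ‖x - η‖ ≤ ‖x - ξ‖ + δ :=
    (norm_sub_le_norm_sub_add_norm_sub x ξ η).trans (by linarith)
  have hsq : ‖x - η‖ ^ 2 ≤ (‖x - ξ‖ + δ) ^ 2 := by gcongr
  rw [← mul_div_assoc, div_le_div_iff₀ (by positivity) (by positivity)]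
  nlinarith [mul_nonneg hδ.le (sq_nonneg (‖x - ξ‖ - δ)), mul_le_mul_of_nonneg_left hsq hδ.le,
    mul_nonneg hδ.le (sq_nonneg ‖x - ξ‖)]

/-- Scaling identity for the dominating profile. -/
theorem div_sq_add_norm_sq_sq_mul_inv_norm_pow {n : ℕ} (hn : 3 ≤ n) {δ : ℝ} (hδ : 0 < δ)
    (y : EuclideanSpace ℝ (Fin n)) :
    (δ / (δ ^ 2 + ‖y‖ ^ 2)) ^ 2 * (‖y‖ ^ (n - 2))⁻¹ =
      (δ ^ n)⁻¹ * (((1 + ‖δ⁻¹ • y‖ ^ 2) ^ 2)⁻¹ * (‖δ⁻¹ • y‖ ^ (n - 2))⁻¹) := by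
  obtain ⟨m, rfl⟩ : ∃ m, n = m + 2 := ⟨n - 2, by omega⟩
  rw [norm_smul, norm_inv, Real.norm_of_nonneg hδ.le, Nat.add_sub_cancel]
  have h : 1 + (δ⁻¹ * ‖y‖) ^ 2 = (δ ^ 2 + ‖y‖ ^ 2) / δ ^ 2 := by field_simp
  rw [h, mul_pow, mul_inv, inv_pow, inv_inv, pow_add]
  field_simp

/-- Interaction estimate `∫_Ω U_i^{p−1} U_j ≤ C δ_j^{(n−2)/2}` when `δ_j ≤ δ_i` and the
centers are at distance `≤ δ_i`. -/
theorem bubble_pm1_interaction_close_centers (n : ℕ) (hn : 3 ≤ n) :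
    ∃ C : ℝ, 0 < C ∧
      ∀ (δi δj : ℝ) (ξi ξj : EuclideanSpace ℝ (Fin n)) (Ω : Set (EuclideanSpace ℝ (Fin n))),
        0 < δj → δj ≤ δi → δi ≤ 1 → ‖ξi - ξj‖ ≤ δi → MeasurableSet Ω →
        ∫ x in Ω, bubble n δi ξi x ^ (((n : ℝ) + 2) / ((n : ℝ) - 2) - 1) * bubble n δj ξj x
          ≤ C * δj ^ (((n : ℝ) - 2) / 2) := by
  have hn' : (3 : ℝ) ≤ n := by exact_mod_cast hn
  set a : ℝ := (n : ℝ) * ((n : ℝ) - 2)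
  have ha : 0 < a := mul_pos (by linarith) (by linarith)
  set G : EuclideanSpace ℝ (Fin n) → ℝ :=
    fun y => ((1 + ‖y‖ ^ 2) ^ 2)⁻¹ * (‖y‖ ^ (n - 2))⁻¹
  have hG : Integrable G := integrable_inv_one_add_norm_sq_sq_mul_inv_norm_pow hn
  have hG0 : ∀ y, 0 ≤ G y := fun y => by positivity
  have hI : 0 ≤ ∫ y, G y := integral_nonneg hG0
  set K : ℝ := a * 9 * a ^ (((n : ℝ) - 2) / 4) with hK_def
  have hK : 0 < K := by positivity
  refine ⟨K * (∫ y, G y) + 1, by positivity, ?_⟩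
  intro δi δj ξi ξj Ω hj hji _ hξ _
  have hi : 0 < δi := hj.trans_le hji
  set D : ℝ := δj ^ (((n : ℝ) - 2) / 2)
  have hD : 0 < D := by positivity
  set g : EuclideanSpace ℝ (Fin n) → ℝ :=
    fun x => K * D * (δi ^ n)⁻¹ * G (δi⁻¹ • (x - ξj)) with hg_def
  have hg : Integrable g :=
    ((hG.comp_smul (inv_ne_zero hi.ne')).comp_sub_right ξj).const_mul _
  have hg0 : ∀ x, 0 ≤ g x := fun x => mul_nonneg (by positivity) (hG0 _)
  have hint : ∫ x, g x = K * D * ∫ y, G y := by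
    rw [hg_def, integral_const_mul,
      integral_sub_right_eq_self (fun x => G (δi⁻¹ • x)) ξj,
      Measure.integral_comp_inv_smul_of_nonneg volume G hi.le, finrank_euclideanSpace,
      Fintype.card_fin, smul_eq_mul]
    field_simp
  have : Nontrivial (Fin n) := Fin.nontrivial_iff_two_le.2 (by omega)
  have hne : ∀ᵐ x : EuclideanSpace ℝ (Fin n), x ≠ ξj := by
    simp [ae_iff]
  have hle : ∀ᵐ x : EuclideanSpace ℝ (Fin n),
      bubble n δi ξi x ^ (((n : ℝ) + 2) / ((n : ℝ) - 2) - 1) * bubble n δj ξj x ≤ g x := by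
    filter_upwards [hne] with x hx
    have h1 : (δi / (δi ^ 2 + ‖x - ξi‖ ^ 2)) ^ 2 ≤
        (3 * (δi / (δi ^ 2 + ‖x - ξj‖ ^ 2))) ^ 2 := by
      gcongr
      exact div_sq_add_norm_sub_sq_le hi hξ x
    calc _ ≤ a * (3 * (δi / (δi ^ 2 + ‖x - ξj‖ ^ 2))) ^ 2 *
          (a ^ (((n : ℝ) - 2) / 4) * (D * (‖x - ξj‖ ^ (n - 2))⁻¹)) := by
          rw [bubble_rpow_sub_one hn hi]
          exact mul_le_mul (mul_le_mul_of_nonneg_left h1 ha.le)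
            (bubble_le_inv_norm_pow hn hj hx) (bubble_nonneg hn hj _ _) (by positivity)
      _ = K * D * ((δi / (δi ^ 2 + ‖x - ξj‖ ^ 2)) ^ 2 * (‖x - ξj‖ ^ (n - 2))⁻¹) := by
          rw [hK_def]
          ring
      _ = g x := by
          rw [div_sq_add_norm_sq_sq_mul_inv_norm_pow hn hi, hg_def]
          ring
  calc _ ≤ ∫ x in Ω, g x := by
        refine integral_mono_of_nonneg (.of_forall fun x => ?_) hg.integrableOn
          (ae_restrict_of_ae hle)
        exact mul_nonneg (Real.rpow_nonneg (bubble_nonneg hn hi _ _) _) (bubble_nonneg hn hj _ _)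
    _ ≤ ∫ x, g x := setIntegral_le_integral hg (.of_forall hg0)
    _ ≤ (K * (∫ y, G y) + 1) * D := by
        rw [hint]
        nlinarith
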